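/- Fix integers k ≥ 1 and d ≥ 1. Then for every ε > 0 there exists n0 such that for every even n ≥ n0 (large enough that η_{k,d,n} is well defined) and every graph G ∈ 𝒢_{kd}(n), |η_{k,d,n}(G) − ν_{kd,n}(G)| ≤ ε·ν_{kd,n}(G); that is, η_{k,d,n}(G) = (1+o(1))·ν_{kd,n}(G) uniformly over all G ∈ 𝒢_{kd}(n). -/

import Mathlib

open Filter Topology

/-- Degree of a vertex in a graph on `Fin n`. -/
noncomputable def gDeg {n : ℕ} (G : SimpleGraph (Fin n)) (v : Fin n) : ℕ :=
  Nat.card {w : Fin n // G.Adj v w}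

/-- `G` is a `d`-regular graph. -/
def IsRegularGraph {n : ℕ} (G : SimpleGraph (Fin n)) (d : ℕ) : Prop :=
  ∀ v, gDeg G v = d

open scoped Classical in
/-- The uniform probability distribution `μ_{d,n}` on the `d`-regular graphs on `{1,…,n}`. -/
noncomputable def mu (n d : ℕ) : SimpleGraph (Fin n) → ℝ := fun G =>
  if IsRegularGraph G d then
    (Nat.card {H : SimpleGraph (Fin n) // IsRegularGraph H d} : ℝ)⁻¹
  else 0

/-- `p` is a probability distribution on a finite or countable space. -/
def IsProbC {α : Type*} (p : α → ℝ) : Prop :=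
  (∀ x, 0 ≤ p x) ∧ ∑' x, p x = 1

/-- Probability of an event `A` under the distribution `p`. -/
noncomputable def probOf {α : Type*} (p : α → ℝ) (A : Set α) : ℝ := ∑' x : A, p x

/-- Total variation distance. -/
noncomputable def tvDist {α : Type*} (p q : α → ℝ) : ℝ := (1/2) * ∑' x, |p x - q x|

/-- `π` is a coupling of `p` and `q`. -/
def IsCoupling {α β : Type*} (π : α × β → ℝ) (p : α → ℝ) (q : β → ℝ) : Prop :=
  IsProbC π ∧ (∀ a, ∑' b, π (a, b) = p a) ∧ (∀ b, ∑' a, π (a, b) = q b)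

/-- Expectation of `f` under the distribution `p`. -/
noncomputable def expec {α : Type*} (p f : α → ℝ) : ℝ := ∑' x, p x * f x

/-- Number of (ordered) 1-factorisations of `G` into `d` perfect matchings. -/
noncomputable def nFact {n : ℕ} (d : ℕ) (G : SimpleGraph (Fin n)) : ℕ :=
  Nat.card {f : Fin d → SimpleGraph (Fin n) //
    (∀ i, IsRegularGraph (f i) 1) ∧ (∀ i j, i ≠ j → Disjoint (f i) (f j)) ∧ (⨆ i, f i) = G}

/-- The distribution `ν_{d,n}`, proportional to the number of 1-factorisations. -/
noncomputable def nu (n d : ℕ) : SimpleGraph (Fin n) → ℝ :=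
  fun G => (nFact d G : ℝ) / ∑' H : SimpleGraph (Fin n), (nFact d H : ℝ)

/-- Number of `k`-tuples of pairwise edge-disjoint graphs whose `i`-th entry is
isomorphic to `B i`. -/
noncomputable def nTuples {n : ℕ} (k : ℕ) (B : Fin k → SimpleGraph (Fin n)) : ℕ :=
  Nat.card {f : Fin k → SimpleGraph (Fin n) //
    (∀ i, Nonempty (B i ≃g f i)) ∧ (∀ i j, i ≠ j → Disjoint (f i) (f j))}

/-- Number of `k`-tuples of pairwise edge-disjoint graphs whose `i`-th entry is
isomorphic to `B i` and whose union is `G`. -/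
noncomputable def nTuplesTo {n : ℕ} (k : ℕ) (B : Fin k → SimpleGraph (Fin n))
    (G : SimpleGraph (Fin n)) : ℕ :=
  Nat.card {f : Fin k → SimpleGraph (Fin n) //
    (∀ i, Nonempty (B i ≃g f i)) ∧ (∀ i j, i ≠ j → Disjoint (f i) (f j)) ∧
      (⨆ i, f i) = G}

/-- The distribution `η_{k,d,n}` of the alternative sampling procedure: sample `k`
isomorphism classes i.i.d. from the push-forward of `ν_{d,n}`, then a uniformly random
edge-disjoint `k`-tuple from these classes, and take the union.  (Summing `∏ ν_{d,n}(B i)`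
over tuples of graphs is the same as summing `∏ ν̄_{d,n}(A i)` over tuples of classes.) -/
noncomputable def etaASP (k d n : ℕ) : SimpleGraph (Fin n) → ℝ := fun G =>
  ∑' B : Fin k → SimpleGraph (Fin n),
    (∏ i, nu n d (B i)) * ((nTuplesTo k B G : ℝ) / (nTuples k B : ℝ))

section SwitchingIdentities

open Finset Equiv

open scoped Classical in
/-- The adjacency indicator of a graph, with values in `ℕ`. -/
noncomputable def adjInd {V : Type*} (G : SimpleGraph V) (u v : V) : ℕ :=
  if G.Adj u v then 1 else 0

/-- The indicator that `(u, v)` is an edge of `H` mapped by `σ` to an edge of `G`. -/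
noncomputable def sharedInd {V : Type*} (G H : SimpleGraph V) (σ : Perm V) (u v : V) : ℕ :=
  adjInd H u v * adjInd G (σ u) (σ v)

/-- The number of ordered pairs which are edges of `H` mapped by `σ` to edges of `G`. -/
noncomputable def sharedCount {V : Type*} [Fintype V] (G H : SimpleGraph V) (σ : Perm V) : ℕ :=
  ∑ u, ∑ v, sharedInd G H σ u v

/-- Every row of the adjacency matrix of `G` sums to `a`. -/
def RowSum {V : Type*} [Fintype V] (G : SimpleGraph V) (a : ℕ) : Prop :=
  ∀ u, ∑ v, adjInd G u v = a

variable {V : Type*}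

lemma adjInd_comm (G : SimpleGraph V) (u v : V) : adjInd G u v = adjInd G v u := by
  unfold adjInd; rw [G.adj_comm]

lemma adjInd_self (G : SimpleGraph V) (u : V) : adjInd G u u = 0 := by
  simp [adjInd]

lemma adjInd_le_one (G : SimpleGraph V) (u v : V) : adjInd G u v ≤ 1 := by
  unfold adjInd; split_ifs <;> simp

lemma sharedInd_comm (G H : SimpleGraph V) (σ : Perm V) (u v : V) :
    sharedInd G H σ u v = sharedInd G H σ v u := by
  simp [sharedInd, adjInd_comm]

lemma sharedInd_self (G H : SimpleGraph V) (σ : Perm V) (u : V) :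
    sharedInd G H σ u u = 0 := by
  simp [sharedInd, adjInd_self]

lemma sharedInd_le_left (G H : SimpleGraph V) (σ : Perm V) (u v : V) :
    sharedInd G H σ u v ≤ adjInd H u v := by
  simpa [sharedInd] using Nat.mul_le_mul_left (adjInd H u v) (adjInd_le_one G (σ u) (σ v))

variable [Fintype V] {G H : SimpleGraph V} {a b : ℕ}

lemma RowSum.sum_left (hG : RowSum G a) (v : V) : ∑ u, adjInd G u v = a := by
  simp_rw [adjInd_comm G _ v]; exact hG v

lemma RowSum.sum_perm (hG : RowSum G a) (σ : Perm V) (u : V) :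
    ∑ v, adjInd G u (σ v) = a := by
  rw [Equiv.sum_comp σ (fun v => adjInd G u v)]; exact hG u

lemma sum_target_weight (hG : RowSum G a) (hH : RowSum H b) (σ : Perm V) :
    ∑ u, ∑ v, ∑ w, adjInd H u v * adjInd G (σ u) (σ w) = Fintype.card V * (a * b) := by
  simp_rw [← Finset.mul_sum, hG.sum_perm, ← Finset.sum_mul, hH _]
  simp only [sum_const, card_univ, smul_eq_mul]
  ring

lemma sharedCount_even (G H : SimpleGraph V) (σ : Perm V) : Even (sharedCount G H σ) := by
  classical
  have h : sharedCount G H σ = ∑ u, (H ⊓ G.comap σ).degree u := by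
    refine Finset.sum_congr rfl fun u _ => ?_
    rw [← SimpleGraph.card_neighborFinset_eq_degree, SimpleGraph.neighborFinset_eq_filter,
      Finset.card_filter]
    refine Finset.sum_congr rfl fun v _ => ?_
    simp only [sharedInd, adjInd, SimpleGraph.inf_adj, SimpleGraph.comap_adj]
    split_ifs <;> simp_all
  rw [h, SimpleGraph.sum_degrees_eq_twice_card_edges]
  exact even_two_mul _

lemma sharedCount_eq_zero_iff (G H : SimpleGraph V) (σ : Perm V) :
    sharedCount G H σ = 0 ↔ Disjoint H (G.comap σ) := by
  rw [disjoint_iff]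
  simp only [sharedCount, sharedInd, adjInd, Finset.sum_eq_zero_iff, mem_univ, true_imp_iff]
  constructor
  · intro h
    ext u v
    have := h u v
    simp only [mul_eq_zero, ite_eq_right_iff, one_ne_zero, imp_false] at this
    simp only [SimpleGraph.inf_adj, SimpleGraph.comap_adj, SimpleGraph.bot_adj]
    tauto
  · intro h u v
    have : ¬ (H ⊓ G.comap σ).Adj u v := by rw [h]; simp
    simp only [SimpleGraph.inf_adj, SimpleGraph.comap_adj] at this
    simp only [mul_eq_zero, ite_eq_right_iff, one_ne_zero, imp_false]
    tauto

variable [DecidableEq V]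

lemma sum_ite_ne_one (f : V) : ∑ w : V, (if w ≠ f then 1 else 0) = Fintype.card V - 1 := by
  rw [Finset.sum_boole]
  simp [Finset.filter_ne']

/-- Right multiplication by the transposition of `x` and `y` permutes the permutations. -/
lemma sum_mul_swap (φ : Perm V → ℕ) (x y : V) :
    ∑ σ, φ (σ * swap x y) = ∑ σ, φ σ :=
  Equiv.sum_comp (Equiv.mulRight (swap x y)) φ

/-- The switching identity: relocating one endpoint of a shared edge is reversed by placing
that endpoint next to the other one. -/
lemma sum_switch (G H : SimpleGraph V) (φ : Perm V → Perm V → V → V → V → ℕ) :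
    ∑ σ, ∑ u, ∑ v, ∑ w, sharedInd G H σ u v * (if w ≠ u then 1 else 0) *
        φ σ (σ * swap v w) u v w =
      ∑ σ : Perm V, ∑ u, ∑ v, ∑ w, adjInd H u v * adjInd G (σ u) (σ w) *
        φ (σ * swap v w) σ u v w := by
  have key : ∀ u v w,
      ∑ σ, sharedInd G H σ u v * (if w ≠ u then 1 else 0) * φ σ (σ * swap v w) u v w =
      ∑ σ : Perm V, adjInd H u v * adjInd G (σ u) (σ w) * φ (σ * swap v w) σ u v w := by
    intro u v w
    rw [← sum_mul_swap _ v w]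
    refine Finset.sum_congr rfl fun σ _ => ?_
    by_cases hw : w = u
    · subst hw; simp [adjInd_self]
    · by_cases huv : u = v
      · subst huv; simp [sharedInd, adjInd_self]
      · have h1 : swap v w u = u := swap_apply_of_ne_of_ne huv (Ne.symm hw)
        simp [sharedInd, hw, h1, mul_assoc]
  calc _ = ∑ u, ∑ v, ∑ w, ∑ σ, sharedInd G H σ u v * (if w ≠ u then 1 else 0) *
        φ σ (σ * swap v w) u v w := by
        rw [Finset.sum_comm]; refine Finset.sum_congr rfl fun u _ => ?_
        rw [Finset.sum_comm]; refine Finset.sum_congr rfl fun v _ => ?_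
        rw [Finset.sum_comm]
    _ = ∑ u, ∑ v, ∑ w, ∑ σ : Perm V, adjInd H u v * adjInd G (σ u) (σ w) *
        φ (σ * swap v w) σ u v w := by simp_rw [key]
    _ = _ := by
        symm
        rw [Finset.sum_comm]; refine Finset.sum_congr rfl fun u _ => ?_
        rw [Finset.sum_comm]; refine Finset.sum_congr rfl fun v _ => ?_
        rw [Finset.sum_comm]

lemma sum_source_weight (G H : SimpleGraph V) (σ : Perm V) :
    ∑ u, ∑ v, ∑ w, sharedInd G H σ u v * (if w ≠ u then 1 else 0) =
      (Fintype.card V - 1) * sharedCount G H σ := by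
  simp_rw [← Finset.mul_sum, sum_ite_ne_one, ← Finset.sum_mul]
  rw [mul_comm, sharedCount]

/-- First switching identity for functions of the source permutation. -/
lemma sum_source_eq (G H : SimpleGraph V) (ψ : Perm V → ℕ) :
    (Fintype.card V - 1) * ∑ σ, sharedCount G H σ * ψ σ =
      ∑ σ : Perm V, ∑ u, ∑ v, ∑ w, adjInd H u v * adjInd G (σ u) (σ w) *
        ψ (σ * swap v w) := by
  rw [← sum_switch G H (fun σ _ _ _ _ => ψ σ), Finset.mul_sum]
  refine Finset.sum_congr rfl fun σ _ => ?_
  simp_rw [← Finset.sum_mul]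
  rw [sum_source_weight, mul_assoc]

lemma sum_sharedCount (hG : RowSum G a) (hH : RowSum H b) :
    (Fintype.card V - 1) * ∑ σ, sharedCount G H σ =
      Fintype.card V * (a * b) * (Fintype.card V).factorial := by
  have := sum_source_eq G H (fun _ => 1)
  simp only [mul_one] at this
  rw [this]
  simp_rw [sum_target_weight hG hH]
  simp [Fintype.card_perm, mul_comm]

/-- A transposition changes the number of shared edges by a bounded amount. -/
lemma sharedCount_mul_swap_le (hH : RowSum H b) (σ : Perm V) (v w : V) :
    sharedCount G H (σ * swap v w) ≤ sharedCount G H σ + 4 * b := by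
  have key : ∀ x y, sharedInd G H (σ * swap v w) x y ≤ sharedInd G H σ x y +
      ((if x = v then adjInd H x y else 0) + (if x = w then adjInd H x y else 0) +
      ((if y = v then adjInd H x y else 0) + (if y = w then adjInd H x y else 0))) := by
    intro x y
    have hle := sharedInd_le_left G H (σ * swap v w) x y
    by_cases h1 : x = v
    · simp only [h1, if_true] at *; omega
    by_cases h2 : x = w
    · simp only [h2, if_true] at *; omega
    by_cases h3 : y = v
    · simp only [h3, if_true] at *; omega
    by_cases h4 : y = w
    · simp only [h4, if_true] at *; omega
    simp [sharedInd, h1, h2, h3, h4, swap_apply_of_ne_of_ne]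
  calc sharedCount G H (σ * swap v w) ≤ ∑ x, ∑ y, (sharedInd G H σ x y +
      ((if x = v then adjInd H x y else 0) + (if x = w then adjInd H x y else 0) +
      ((if y = v then adjInd H x y else 0) + (if y = w then adjInd H x y else 0)))) :=
        Finset.sum_le_sum fun x _ => Finset.sum_le_sum fun y _ => key x y
    _ = _ := by
        have e1 : ∀ v : V, ∑ x, ∑ y, (if x = v then adjInd H x y else 0) = b := by
          intro v
          rw [Finset.sum_comm]
          simpa using hH v
        have e2 : ∀ v : V, ∑ x, ∑ y, (if y = v then adjInd H x y else 0) = b := by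
          intro v
          simpa using hH.sum_left v
        simp only [Finset.sum_add_distrib, e1, e2, sharedCount]
        ring

lemma sum_sharedCount_sq_le (hG : RowSum G a) (hH : RowSum H b) :
    (Fintype.card V - 1) * ∑ σ, sharedCount G H σ * sharedCount G H σ ≤
      Fintype.card V * (a * b) *
        (∑ σ, sharedCount G H σ + 4 * b * (Fintype.card V).factorial) := by
  rw [sum_source_eq G H]
  calc _ ≤ ∑ σ : Perm V, ∑ u, ∑ v, ∑ w, adjInd H u v * adjInd G (σ u) (σ w) *
        (sharedCount G H σ + 4 * b) := by
        gcongr; exact sharedCount_mul_swap_le hH _ _ _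
    _ = _ := by
        simp_rw [← Finset.sum_mul, sum_target_weight hG hH, ← Finset.mul_sum,
          Finset.sum_add_distrib]
        simp [Fintype.card_perm, mul_comm]

/-- The number of shared paths of length two with middle vertex `v`, as ordered triples. -/
noncomputable def cherryInd (G H : SimpleGraph V) (σ : Perm V) (u v x : V) : ℕ :=
  sharedInd G H σ u v * ((if x ≠ u then 1 else 0) * sharedInd G H σ v x)

lemma sum_adj_pair_le (hG : RowSum G a) {u v : V} (huv : u ≠ v) :
    (Fintype.card V - 1) * ∑ σ : Perm V, adjInd G (σ u) (σ v) ≤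
      a * (Fintype.card V).factorial := by
  rw [← sum_ite_ne_one v, Finset.sum_mul]
  calc ∑ w, (if w ≠ v then 1 else 0) * ∑ σ : Perm V, adjInd G (σ u) (σ v)
      ≤ ∑ w, ∑ σ : Perm V, adjInd G (σ w) (σ v) := by
        refine Finset.sum_le_sum fun w _ => ?_
        by_cases hw : w = v
        · simp [hw]
        · rw [← sum_mul_swap (fun σ : Perm V => adjInd G (σ u) (σ v)) u w]
          have : swap u w v = v := swap_apply_of_ne_of_ne huv.symm (Ne.symm hw)
          simp [hw, this]
    _ = ∑ σ : Perm V, ∑ w, adjInd G (σ w) (σ v) := Finset.sum_comm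
    _ = _ := by
        have : ∀ σ : Perm V, ∑ w, adjInd G (σ w) (σ v) = a := fun σ => by
          rw [Equiv.sum_comp σ (fun w => adjInd G w (σ v))]; exact hG.sum_left _
        simp [this, Fintype.card_perm, mul_comm]

lemma sum_adj_path_le (hG : RowSum G a) {u v x : V} (huv : u ≠ v) (hvx : v ≠ x) (hxu : x ≠ u) :
    (Fintype.card V - 2) * ((Fintype.card V - 1) *
      ∑ σ : Perm V, adjInd G (σ u) (σ v) * adjInd G (σ v) (σ x)) ≤
      a * (a * (Fintype.card V).factorial) := by
  have hcard : ∑ w : V, (if w ≠ u ∧ w ≠ v then 1 else 0) = Fintype.card V - 2 := by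
    rw [Finset.sum_boole]
    have : ({w | w ≠ u ∧ w ≠ v} : Finset V) = (univ.erase u).erase v := by
      ext; simp [and_comm]
    rw [this, Finset.card_erase_of_mem (by simp [huv.symm]), Finset.card_erase_of_mem (by simp)]
    simp; omega
  have step : (Fintype.card V - 2) *
      ∑ σ : Perm V, adjInd G (σ u) (σ v) * adjInd G (σ v) (σ x) ≤
      a * ∑ σ : Perm V, adjInd G (σ u) (σ v) := by
    rw [← hcard, Finset.sum_mul]
    calc ∑ w, (if w ≠ u ∧ w ≠ v then 1 else 0) *
          ∑ σ : Perm V, adjInd G (σ u) (σ v) * adjInd G (σ v) (σ x)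
        ≤ ∑ w, ∑ σ : Perm V, adjInd G (σ u) (σ v) * adjInd G (σ v) (σ w) := by
          refine Finset.sum_le_sum fun w _ => ?_
          by_cases hw : w ≠ u ∧ w ≠ v
          · rw [← sum_mul_swap (fun σ : Perm V =>
              adjInd G (σ u) (σ v) * adjInd G (σ v) (σ x)) x w]
            have h1 : swap x w v = v := swap_apply_of_ne_of_ne hvx hw.2.symm
            have h2 : swap x w u = u := swap_apply_of_ne_of_ne hxu.symm hw.1.symm
            simp [hw, h1, h2]
          · simp [hw]
      _ = ∑ σ : Perm V, ∑ w, adjInd G (σ u) (σ v) * adjInd G (σ v) (σ w) := Finset.sum_comm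
      _ = _ := by
          simp_rw [← Finset.mul_sum, hG.sum_perm, ← Finset.sum_mul, mul_comm]
  calc _ = (Fintype.card V - 1) * ((Fintype.card V - 2) *
      ∑ σ : Perm V, adjInd G (σ u) (σ v) * adjInd G (σ v) (σ x)) := by ring
    _ ≤ (Fintype.card V - 1) * (a * ∑ σ : Perm V, adjInd G (σ u) (σ v)) :=
        Nat.mul_le_mul_left _ step
    _ = a * ((Fintype.card V - 1) * ∑ σ : Perm V, adjInd G (σ u) (σ v)) := by ring
    _ ≤ _ := Nat.mul_le_mul_left _ (sum_adj_pair_le hG huv)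

lemma sum_cherry_le (hG : RowSum G a) (hH : RowSum H b) :
    (Fintype.card V - 2) * ((Fintype.card V - 1) *
      ∑ σ, ∑ u, ∑ v, ∑ x, cherryInd G H σ u v x) ≤
      Fintype.card V * (b * b) * (a * (a * (Fintype.card V).factorial)) := by
  have key : ∀ u v x, (Fintype.card V - 2) * ((Fintype.card V - 1) *
      ∑ σ, cherryInd G H σ u v x) ≤
      adjInd H u v * adjInd H v x * (a * (a * (Fintype.card V).factorial)) := by
    intro u v x
    by_cases huv : u = v
    · subst huv; simp [cherryInd, sharedInd_self]
    by_cases hvx : v = x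
    · subst hvx; simp [cherryInd, sharedInd_self]
    by_cases hxu : x = u
    · simp [cherryInd, hxu]
    have : ∀ σ, cherryInd G H σ u v x =
        adjInd H u v * adjInd H v x * (adjInd G (σ u) (σ v) * adjInd G (σ v) (σ x)) := by
      intro σ; simp [cherryInd, sharedInd, hxu]; ring
    simp_rw [this, ← Finset.mul_sum]
    calc _ = adjInd H u v * adjInd H v x * ((Fintype.card V - 2) * ((Fintype.card V - 1) *
      ∑ σ : Perm V, adjInd G (σ u) (σ v) * adjInd G (σ v) (σ x))) := by ring
      _ ≤ _ := Nat.mul_le_mul_left _ (sum_adj_path_le hG huv hvx hxu)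
  have swp : ∑ σ, ∑ u, ∑ v, ∑ x, cherryInd G H σ u v x =
      ∑ u, ∑ v, ∑ x, ∑ σ, cherryInd G H σ u v x := by
    rw [Finset.sum_comm]; refine Finset.sum_congr rfl fun u _ => ?_
    rw [Finset.sum_comm]; refine Finset.sum_congr rfl fun v _ => ?_
    rw [Finset.sum_comm]
  rw [swp]
  simp_rw [Finset.mul_sum]
  calc _ ≤ ∑ u, ∑ v, ∑ x, adjInd H u v * adjInd H v x *
        (a * (a * (Fintype.card V).factorial)) := by
        gcongr with u _ v _ x _
        simpa [Finset.mul_sum] using key u v x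
    _ = _ := by
        simp_rw [← Finset.sum_mul, ← Finset.mul_sum, hH _, ← Finset.sum_mul, hH _]
        simp [mul_assoc]

/-- If the switched permutation creates or destroys no shared edge besides the relocated one,
it has exactly two fewer ordered shared pairs. -/
lemma sharedCount_eq_add_two {σ : Perm V} {u v w : V} (hs : sharedInd G H σ u v = 1)
    (hv : ∀ x, sharedInd G H (σ * swap v w) v x = 0)
    (hw : ∀ x, sharedInd G H (σ * swap v w) w x = 0)
    (hw' : ∀ x, sharedInd G H σ w x = 0)
    (hv' : ∀ x, x ≠ u → sharedInd G H σ v x = 0) :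
    sharedCount G H σ = sharedCount G H (σ * swap v w) + 2 := by
  have huv : u ≠ v := by rintro rfl; simp [sharedInd_self] at hs
  have key : ∀ x y, sharedInd G H σ x y = sharedInd G H (σ * swap v w) x y +
      ((if x = u then (if y = v then 1 else 0) else 0) +
        (if x = v then (if y = u then 1 else 0) else 0)) := by
    intro x y
    by_cases h1 : x = v
    · subst h1
      by_cases h2 : y = u
      · subst h2; simp [hv, sharedInd_comm G H σ x, hs, huv.symm]
      · simp [hv, hv' y h2, h2, huv.symm]
    by_cases h3 : y = v
    · subst h3
      by_cases h2 : x = u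
      · subst h2; simp [hs, sharedInd_comm _ _ _ x, hv, huv]
      · simp [sharedInd_comm _ _ _ x, hv, hv' x h2, h2, h1]
    have e : ∀ z : V, z ≠ v → z ≠ w → swap v w z = z := fun z hz hz' => swap_apply_of_ne_of_ne hz hz'
    by_cases h4 : x = w
    · subst h4; simp [hw, hw', h1, h3]
    by_cases h5 : y = w
    · subst h5; simp [sharedInd_comm _ _ _ x, hw, hw', h1, h3]
    simp [sharedInd, h1, h3, e x h1 h4, e y h3 h5]
  unfold sharedCount
  simp_rw [key, Finset.sum_add_distrib]
  simp

lemma sharedCount_ne_indicator_le {σ : Perm V} {u v w : V} :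
    sharedInd G H σ u v *
      (if sharedCount G H σ = sharedCount G H (σ * swap v w) + 2 then 0 else 1) ≤
    sharedInd G H σ u v * ((∑ x, sharedInd G H (σ * swap v w) v x) +
      (∑ x, sharedInd G H (σ * swap v w) w x) + (∑ x, sharedInd G H σ w x) +
      ∑ x, (if x ≠ u then 1 else 0) * sharedInd G H σ v x) := by
  by_cases hs : sharedInd G H σ u v = 0
  · simp [hs]
  refine Nat.mul_le_mul_left _ ?_
  have hs : sharedInd G H σ u v = 1 := by
    have h1 := sharedInd_le_left G H σ u v
    have h2 := adjInd_le_one H u v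
    omega
  split_ifs with h
  · simp
  by_contra! hlt
  refine h (sharedCount_eq_add_two hs ?_ ?_ ?_ ?_)
  all_goals
    simp only [Nat.lt_one_iff, Nat.add_eq_zero_iff, Finset.sum_eq_zero_iff, mem_univ,
      true_imp_iff] at hlt
  · exact hlt.1.1.1
  · exact hlt.1.1.2
  · exact hlt.1.2
  · intro x hx; simpa [hx] using hlt.2 x

/-- The total weight of the switchings which do not destroy exactly one shared edge. -/
noncomputable def badSwitch (G H : SimpleGraph V) : ℕ :=
  ∑ σ : Perm V, ∑ u, ∑ v, ∑ w, sharedInd G H σ u v * (if w ≠ u then 1 else 0) *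
    (if sharedCount G H σ = sharedCount G H (σ * swap v w) + 2 then 0 else 1)

lemma badSwitch_le (hG : RowSum G a) (hH : RowSum H b) :
    badSwitch G H ≤ 2 * (a * b) * (∑ σ, sharedCount G H σ) +
      (∑ σ, sharedCount G H σ * sharedCount G H σ) +
      Fintype.card V * ∑ σ, ∑ u, ∑ v, ∑ x, cherryInd G H σ u v x := by
  have h1 : ∑ σ : Perm V, ∑ u, ∑ v, ∑ w, sharedInd G H σ u v * (if w ≠ u then 1 else 0) *
      (∑ x, sharedInd G H (σ * swap v w) v x) = (a * b) * ∑ σ, sharedCount G H σ := by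
    rw [sum_switch G H (fun _ τ _ v _ => ∑ x, sharedInd G H τ v x), Finset.mul_sum]
    refine Finset.sum_congr rfl fun σ _ => ?_
    simp_rw [← Finset.sum_mul, ← Finset.mul_sum, hG.sum_perm]
    rw [Finset.sum_comm]
    simp_rw [← Finset.sum_mul, hH.sum_left]
    rw [← Finset.mul_sum, sharedCount, mul_comm a b]
  have h2 : ∑ σ : Perm V, ∑ u, ∑ v, ∑ w, sharedInd G H σ u v * (if w ≠ u then 1 else 0) *
      (∑ x, sharedInd G H (σ * swap v w) w x) = (a * b) * ∑ σ, sharedCount G H σ := by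
    rw [sum_switch G H (fun _ τ _ _ w => ∑ x, sharedInd G H τ w x), Finset.mul_sum]
    refine Finset.sum_congr rfl fun σ _ => ?_
    simp_rw [mul_assoc, ← Finset.mul_sum, ← Finset.sum_mul, hH _, ← Finset.mul_sum]
    rw [Finset.sum_comm]
    simp_rw [← Finset.sum_mul]
    have : ∀ w, ∑ u, adjInd G (σ u) (σ w) = a := fun w => by
      simp_rw [adjInd_comm G _ (σ w)]; exact hG.sum_perm σ _
    simp_rw [this]
    rw [← Finset.mul_sum, sharedCount]
    ring
  have h3 : ∑ σ : Perm V, ∑ u, ∑ v, ∑ w, sharedInd G H σ u v * (if w ≠ u then 1 else 0) *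
      (∑ x, sharedInd G H σ w x) ≤ ∑ σ, sharedCount G H σ * sharedCount G H σ := by
    refine Finset.sum_le_sum fun σ _ => ?_
    calc _ ≤ ∑ u, ∑ v, ∑ w, sharedInd G H σ u v * (∑ x, sharedInd G H σ w x) := by
          gcongr with u _ v _ w _
          split_ifs <;> simp
      _ = _ := by
          simp_rw [← Finset.mul_sum, ← Finset.sum_mul]
          rfl
  have h4 : ∑ σ : Perm V, ∑ u, ∑ v, ∑ w, sharedInd G H σ u v * (if w ≠ u then 1 else 0) *
      (∑ x, (if x ≠ u then 1 else 0) * sharedInd G H σ v x) ≤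
      Fintype.card V * ∑ σ, ∑ u, ∑ v, ∑ x, cherryInd G H σ u v x := by
    rw [Finset.mul_sum]
    refine Finset.sum_le_sum fun σ _ => ?_
    calc _ ≤ ∑ u, ∑ v, ∑ _w : V, sharedInd G H σ u v *
          (∑ x, (if x ≠ u then 1 else 0) * sharedInd G H σ v x) := by
          gcongr with u _ v _ w _
          split_ifs <;> simp
      _ = _ := by
          simp [cherryInd, Finset.mul_sum]
  calc badSwitch G H ≤ ∑ σ : Perm V, ∑ u, ∑ v, ∑ w,
        sharedInd G H σ u v * (if w ≠ u then 1 else 0) *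
        ((∑ x, sharedInd G H (σ * swap v w) v x) +
        (∑ x, sharedInd G H (σ * swap v w) w x) + (∑ x, sharedInd G H σ w x) +
        ∑ x, (if x ≠ u then 1 else 0) * sharedInd G H σ v x) := by
        unfold badSwitch
        refine Finset.sum_le_sum fun σ _ => Finset.sum_le_sum fun u _ =>
          Finset.sum_le_sum fun v _ => Finset.sum_le_sum fun w _ => ?_
        rw [mul_right_comm _ (if w ≠ u then 1 else 0), mul_right_comm _ (if w ≠ u then 1 else 0)]
        exact Nat.mul_le_mul_right _
          (sharedCount_ne_indicator_le (G := G) (H := H) (σ := σ) (u := u) (v := v) (w := w))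
    _ ≤ _ := by
        simp only [mul_add, Finset.sum_add_distrib]
        rw [h1, h2]
        refine (add_le_add (add_le_add le_rfl h3) h4).trans (le_of_eq ?_)
        ring

/-- The number of permutations with exactly `j` ordered shared pairs. -/
noncomputable def levelCount (G H : SimpleGraph V) (j : ℕ) : ℕ :=
  #{σ : Perm V | sharedCount G H σ = j}

lemma sum_source_level (G H : SimpleGraph V) (j : ℕ) :
    ∑ σ : Perm V, ∑ u, ∑ v, ∑ w, sharedInd G H σ u v * (if w ≠ u then 1 else 0) *
      (if sharedCount G H σ = j then 1 else 0) =
    (Fintype.card V - 1) * (j * levelCount G H j) := by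
  simp_rw [← Finset.sum_mul, sum_source_weight]
  rw [levelCount, Finset.card_filter, Finset.mul_sum, Finset.mul_sum]
  refine Finset.sum_congr rfl fun σ _ => ?_
  split_ifs with h
  · simp [h]
  · simp

lemma sum_target_level (hG : RowSum G a) (hH : RowSum H b) (j : ℕ) :
    ∑ σ : Perm V, ∑ u, ∑ v, ∑ w, sharedInd G H σ u v * (if w ≠ u then 1 else 0) *
      (if sharedCount G H (σ * swap v w) = j then 1 else 0) =
    Fintype.card V * (a * b) * levelCount G H j := by
  rw [sum_switch G H (fun _ τ _ _ _ => if sharedCount G H τ = j then 1 else 0)]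
  simp_rw [← Finset.sum_mul, sum_target_weight hG hH]
  rw [levelCount, Finset.card_filter, Finset.mul_sum]

lemma levelCount_succ_le (hG : RowSum G a) (hH : RowSum H b) (j : ℕ) :
    (Fintype.card V - 1) * ((j + 2) * levelCount G H (j + 2)) ≤
      Fintype.card V * (a * b) * levelCount G H j + badSwitch G H := by
  rw [← sum_source_level, ← sum_target_level hG hH, badSwitch]
  simp only [← Finset.sum_add_distrib, ← mul_add]
  gcongr with σ _ u _ v _ w _
  split_ifs <;> omega

lemma levelCount_le_succ (hG : RowSum G a) (hH : RowSum H b) (j : ℕ) :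
    Fintype.card V * (a * b) * levelCount G H j ≤
      (Fintype.card V - 1) * ((j + 2) * levelCount G H (j + 2)) + badSwitch G H := by
  rw [← sum_source_level, ← sum_target_level hG hH, badSwitch]
  simp only [← Finset.sum_add_distrib, ← mul_add]
  gcongr with σ _ u _ v _ w _
  split_ifs <;> omega

/-- The bad switchings are negligible. -/
lemma badSwitch_le_const (hG : RowSum G a) (hH : RowSum H b) (hV : 4 ≤ Fintype.card V) :
    badSwitch G H ≤ (2 * (a * b) * (2 * (a * b)) + 2 * (a * b) * (2 * (a * b) + 4 * b) +
      4 * (b * b * (a * a))* 2) * (Fintype.card V).factorial := by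
  have h := badSwitch_le hG hH
  have h1 := sum_sharedCount hG hH
  have h2 := sum_sharedCount_sq_le hG hH
  have h3 := sum_cherry_le hG hH
  set A := ∑ σ, sharedCount G H σ
  set B := ∑ σ, sharedCount G H σ * sharedCount G H σ
  set C := ∑ σ, ∑ u, ∑ v, ∑ x, cherryInd G H σ u v x
  generalize (Fintype.card V).factorial = F at *
  obtain ⟨n, hn⟩ : ∃ n, Fintype.card V = n + 2 := ⟨Fintype.card V - 2, by omega⟩
  rw [hn] at h h1 h2 h3 hV
  have e1 : n + 2 - 1 = n + 1 := by omega
  have e2 : n + 2 - 2 = n := by omega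
  rw [e1] at h1 h2 h3
  rw [e2] at h3
  have hA : A ≤ 2 * (a * b) * F := by
    refine le_of_mul_le_mul_left (a := n + 1) ?_ (by omega)
    rw [h1]
    have h4 : n + 2 ≤ 2 * (n + 1) := by omega
    have := Nat.mul_le_mul_right (a * b * F) h4
    linarith
  have hB : B ≤ 2 * (a * b) * (2 * (a * b) + 4 * b) * F := by
    refine le_of_mul_le_mul_left (a := n + 1) ?_ (by omega)
    refine h2.trans ?_
    have : (n + 2) * (a * b * (A + 4 * b * F)) ≤
        (2 * (n + 1)) * (a * b * (2 * (a * b) * F + 4 * b * F)) := by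
      have h4 : n + 2 ≤ 2 * (n + 1) := by omega
      gcongr
    linarith
  have hC : (n + 2) * C ≤ 4 * (b * b * (a * a)) * 2 * F := by
    refine le_of_mul_le_mul_left (a := n * (n + 1)) ?_ (Nat.mul_pos (by omega) (by omega))
    have : (n + 2) * (n + 2) ≤ 8 * (n * (n + 1)) := by nlinarith
    calc n * (n + 1) * ((n + 2) * C) = (n + 2) * (n * ((n + 1) * C)) := by ring
      _ ≤ (n + 2) * ((n + 2) * (b * b) * (a * (a * F))) := Nat.mul_le_mul_left _ h3
      _ = ((n + 2) * (n + 2)) * (b * b * (a * a) * F) := by ring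
      _ ≤ (8 * (n * (n + 1))) * (b * b * (a * a) * F) := Nat.mul_le_mul_right _ this
      _ = _ := by ring
  calc _ ≤ _ := h
    _ ≤ 2 * (a * b) * (2 * (a * b) * F) + 2 * (a * b) * (2 * (a * b) + 4 * b) * F +
        4 * (b * b * (a * a)) * 2 * F := by gcongr
    _ = _ := by ring

lemma mul_factorial_le_sum_levelCount (hG : RowSum G a) (hH : RowSum H b)
    (hV : 2 ≤ Fintype.card V) (K : ℕ) :
    K * (Fintype.card V).factorial ≤
      K * (∑ i ∈ range K, levelCount G H (2 * i)) + (a * b) * (Fintype.card V).factorial := by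
  have h1 : (∑ i ∈ range K, levelCount G H (2 * i)) =
      ∑ σ : Perm V, if sharedCount G H σ < 2 * K then 1 else 0 := by
    simp_rw [levelCount, Finset.card_filter]
    rw [Finset.sum_comm]
    refine Finset.sum_congr rfl fun σ _ => ?_
    obtain ⟨r, hr⟩ := sharedCount_even G H σ
    have : ∀ i, (sharedCount G H σ = 2 * i) ↔ r = i := fun i => by omega
    simp_rw [this]
    have : (sharedCount G H σ < 2 * K) ↔ r < K := by omega
    simp [this]
  have h2 : (∑ σ : Perm V, sharedCount G H σ) ≤ 2 * (a * b) * (Fintype.card V).factorial := by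
    refine le_of_mul_le_mul_left (a := Fintype.card V - 1) ?_ (by omega)
    rw [sum_sharedCount hG hH]
    have h3 : Fintype.card V ≤ 2 * (Fintype.card V - 1) := by omega
    have := Nat.mul_le_mul_right (a * b * (Fintype.card V).factorial) h3
    linarith
  have h3 : 2 * (K * (Fintype.card V).factorial) ≤
      2 * (K * (∑ i ∈ range K, levelCount G H (2 * i))) + ∑ σ : Perm V, sharedCount G H σ := by
    rw [h1]
    have : (Fintype.card V).factorial = ∑ σ : Perm V, 1 := by simp [Fintype.card_perm]
    rw [this]
    simp_rw [Finset.mul_sum]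
    rw [← Finset.sum_add_distrib]
    refine Finset.sum_le_sum fun σ _ => ?_
    split_ifs <;> omega
  linarith
end SwitchingIdentities

section PoissonLimit

open Finset Equiv

/-- An approximate, tight Poisson recursion determines the limit of the probability of `0`. -/
lemma tendsto_exp_neg_of_recursion {T : Type*} {l : Filter T} {p : ℕ → T → ℝ} {r C : ℝ}
    (h0 : ∀ t, 0 ≤ p 0 t) (h1 : ∀ t, p 0 t ≤ 1)
    (hrec : ∀ i : ℕ, Tendsto (fun t => (i + 1) * p (i + 1) t - r * p i t) l (𝓝 0))
    (htight : ∀ K : ℕ, ∀ᶠ t in l, K * |1 - ∑ i ∈ range K, p i t| ≤ C) :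
    Tendsto (p 0) l (𝓝 (Real.exp (-r))) := by
  have h2 : ∀ i : ℕ, Tendsto (fun t => p i t - r ^ i / i.factorial * p 0 t) l (𝓝 0) := by
    intro i
    induction i with
    | zero => simpa using tendsto_const_nhds
    | succ i ih =>
      have := ((hrec i).add (ih.const_mul r)).const_mul (1 / ((i : ℝ) + 1))
      simp only [mul_zero, add_zero] at this
      refine this.congr fun t => ?_
      have hi : (i : ℝ) + 1 ≠ 0 := by positivity
      have hf : (i.factorial : ℝ) ≠ 0 := by positivity
      rw [Nat.factorial_succ]
      push_cast
      field_simp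
      ring
  have h3 : ∀ K : ℕ, Tendsto (fun t => ∑ i ∈ range K, p i t -
      (∑ i ∈ range K, r ^ i / i.factorial) * p 0 t) l (𝓝 0) := by
    intro K
    have := tendsto_finsetSum (range K) fun i _ => h2 i
    simp only [Finset.sum_sub_distrib, ← Finset.sum_mul, Finset.sum_const_zero] at this
    exact this
  have hexp : Tendsto (fun K => ∑ i ∈ range K, r ^ i / i.factorial) atTop (𝓝 (Real.exp r)) := by
    rw [Real.exp_eq_exp_ℝ]
    exact (NormedSpace.expSeries_div_hasSum_exp r).tendsto_sum_nat
  have hmain : Tendsto (fun t => Real.exp r * p 0 t) l (𝓝 1) := by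
    rw [Metric.tendsto_nhds]
    intro ε hε
    have e1 := (Metric.tendsto_nhds.1 hexp) (ε / 3) (by positivity)
    have e2 := (tendsto_natCast_atTop_atTop (R := ℝ)).eventually_gt_atTop (C / (ε / 3))
    obtain ⟨K, hK1, hK2, hK3⟩ := (e1.and (e2.and (eventually_gt_atTop 0))).exists
    have hKpos : (0 : ℝ) < K := by exact_mod_cast hK3
    filter_upwards [htight K, (Metric.tendsto_nhds.1 (h3 K)) (ε / 3) (by positivity)]
      with t ht1 ht2
    rw [Real.dist_eq] at *
    have ht3 : |1 - ∑ i ∈ range K, p i t| < ε / 3 := by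
      rw [div_lt_iff₀ (by positivity)] at hK2
      by_contra! hle
      nlinarith
    have ht4 : |(∑ i ∈ range K, r ^ i / i.factorial - Real.exp r) * p 0 t| < ε / 3 := by
      rw [abs_mul, abs_of_nonneg (h0 t)]
      nlinarith [h0 t, h1 t, abs_nonneg (∑ i ∈ range K, r ^ i / i.factorial - Real.exp r)]
    rw [sub_zero] at ht2
    rw [sub_mul] at ht4
    rw [abs_lt] at *
    constructor <;> linarith [ht2.1, ht2.2, ht3.1, ht3.2, ht4.1, ht4.2]
  have := hmain.const_mul (Real.exp (-r))
  simpa [← mul_assoc, ← Real.exp_add] using this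

/-- Pairs of an `a`-regular and a `b`-regular graph of arbitrary common order. -/
abbrev RegPair (a b : ℕ) : Type :=
  Σ n : ℕ, {P : SimpleGraph (Fin n) × SimpleGraph (Fin n) // RowSum P.1 a ∧ RowSum P.2 b}

/-- The filter of regular pairs whose order tends to infinity. -/
def regPairAtTop (a b : ℕ) : Filter (RegPair a b) := comap Sigma.fst atTop

/-- The probability that a uniformly random relabelling shares exactly `i` edges. -/
noncomputable def levelProb (a b i : ℕ) (t : RegPair a b) : ℝ :=
  levelCount t.2.1.1 t.2.1.2 (2 * i) / t.1.factorial

lemma levelCount_le_factorial {n : ℕ} (G H : SimpleGraph (Fin n)) (j : ℕ) :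
    levelCount G H j ≤ n.factorial := by
  refine (Finset.card_le_univ _).trans ?_
  simp [Fintype.card_perm]

lemma levelProb_nonneg (a b i : ℕ) (t : RegPair a b) : 0 ≤ levelProb a b i t := by
  unfold levelProb; positivity

lemma levelProb_le_one (a b i : ℕ) (t : RegPair a b) : levelProb a b i t ≤ 1 := by
  refine div_le_one_of_le₀ ?_ (by positivity)
  exact_mod_cast levelCount_le_factorial _ _ _

lemma exists_levelProb_recursion_bound (a b : ℕ) : ∃ C : ℝ, ∀ i : ℕ, ∀ t : RegPair a b, 4 ≤ t.1 →
    |(i + 1) * levelProb a b (i + 1) t - (a * b / 2 : ℝ) * levelProb a b i t| ≤ C / t.1 := by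
  obtain ⟨C, hC⟩ : ∃ C : ℕ, C = (2 * (a * b) * (2 * (a * b)) +
    2 * (a * b) * (2 * (a * b) + 4 * b) + 4 * (b * b * (a * a)) * 2) := ⟨_, rfl⟩
  refine ⟨C + a * b, ?_⟩
  rintro i ⟨n, ⟨⟨G, H⟩, hG, hH⟩⟩ hn
  dsimp only at hn hG hH
  have hbad := badSwitch_le_const hG hH (by simpa using hn)
  have h1 := levelCount_succ_le hG hH (2 * i)
  have h2 := levelCount_le_succ hG hH (2 * i)
  rw [← hC] at hbad
  have hle := levelCount_le_factorial G H (2 * i)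
  simp only [Fintype.card_fin] at hbad h1 h2
  simp only [levelProb]
  rw [show 2 * i + 2 = 2 * (i + 1) by ring] at h1 h2
  obtain ⟨m, rfl⟩ : ∃ m, n = m + 1 := ⟨n - 1, by omega⟩
  rw [Nat.add_sub_cancel] at h1 h2
  generalize levelCount G H (2 * (i + 1)) = x at *
  generalize levelCount G H (2 * i) = y at *
  generalize badSwitch G H = B at *
  have hF : (0 : ℝ) < (m + 1).factorial := by positivity
  generalize (m + 1).factorial = F at *
  have h1' : (m : ℝ) * ((2 * (i + 1)) * x) ≤ (m + 1) * (a * b) * y + C * F := by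
    exact_mod_cast h1.trans (Nat.add_le_add_left hbad _)
  have h2' : ((m : ℝ) + 1) * (a * b) * y ≤ m * ((2 * (i + 1)) * x) + C * F := by
    exact_mod_cast h2.trans (Nat.add_le_add_left hbad _)
  have hy : (y : ℝ) ≤ F := by exact_mod_cast hle
  have hy0 : (0 : ℝ) ≤ y := by positivity
  have hm : (3 : ℝ) ≤ m := by exact_mod_cast (by omega : 3 ≤ m)
  have hab : (0 : ℝ) ≤ a * b := by positivity
  have hC0 : (0 : ℝ) ≤ C := by positivity
  have e : ((i : ℝ) + 1) * (x / F) - (a * b / 2) * (y / F) =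
      (2 * (i + 1) * x - a * b * y) / (2 * F) := by field_simp
  rw [e]
  have hz : |2 * ((i : ℝ) + 1) * x - a * b * y| * m ≤ (C + a * b) * F := by
    have h7 : ∀ z : ℝ, |z| * m = |z * m| := fun z => by
      rw [abs_mul, abs_of_nonneg (by linarith : (0 : ℝ) ≤ m)]
    rw [h7]
    have h5 := mul_le_mul_of_nonneg_left hy hab
    have h6 := mul_nonneg hab hy0
    rw [abs_le]
    constructor <;> nlinarith
  rw [abs_div, abs_of_pos (by positivity : 0 < 2 * (F : ℝ)), div_le_div_iff₀ (by positivity)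
    (by positivity)]
  push_cast
  nlinarith [abs_nonneg (2 * ((i : ℝ) + 1) * x - a * b * y)]

lemma tendsto_levelProb_zero (a b : ℕ) :
    Tendsto (levelProb a b 0) (regPairAtTop a b) (𝓝 (Real.exp (-(a * b / 2)))) := by
  have hfst : Tendsto (fun t : RegPair a b => t.1) (regPairAtTop a b) atTop := tendsto_comap
  refine tendsto_exp_neg_of_recursion (C := a * b) (levelProb_nonneg a b 0)
    (levelProb_le_one a b 0) ?_ ?_
  · intro i
    obtain ⟨C, hC⟩ := exists_levelProb_recursion_bound a b
    have h := (tendsto_natCast_atTop_atTop (R := ℝ)).comp hfst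
    refine squeeze_zero_norm' (a := fun t : RegPair a b => C / (t.1 : ℝ)) ?_
      (h.const_div_atTop C)
    filter_upwards [hfst.eventually_ge_atTop 4] with t ht
    exact hC i t ht
  · intro K
    filter_upwards [hfst.eventually_ge_atTop 4] with t ht
    obtain ⟨n, ⟨⟨G, H⟩, hG, hH⟩⟩ := t
    dsimp only at ht hG hH
    have h := mul_factorial_le_sum_levelCount hG hH (by simp; omega) K
    have h' : ∑ i ∈ range K, levelCount G H (2 * i) ≤ n.factorial := by
      have : ∑ i ∈ range K, levelCount G H (2 * i) =
          #((range K).biUnion fun i => {σ : Perm (Fin n) | sharedCount G H σ = 2 * i}) := by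
        rw [Finset.card_biUnion]
        · rfl
        · intro i _ j _ hij
          rw [Function.onFun, Finset.disjoint_left]
          intro σ h1 h2
          simp only [mem_filter, mem_univ, true_and] at h1 h2
          omega
      rw [this]
      refine (Finset.card_le_univ _).trans ?_
      simp [Fintype.card_perm]
    simp only [Fintype.card_fin] at h
    simp only [levelProb, ← Finset.sum_div]
    have hF : (0 : ℝ) < n.factorial := by positivity
    rw [← Nat.cast_sum]
    generalize ∑ i ∈ range K, levelCount G H (2 * i) = S at *
    generalize n.factorial = F at *
    have e : 1 - (S : ℝ) / F = (F - S) / F := by field_simp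
    have hS : (S : ℝ) ≤ F := by exact_mod_cast h'
    have h2 : (K : ℝ) * F ≤ K * S + (a * b) * F := by exact_mod_cast h
    rw [e, abs_of_nonneg (div_nonneg (by linarith) hF.le), ← mul_div_assoc, div_le_iff₀ hF]
    linarith

/-- A random relabelling of an `a`-regular graph avoids a `b`-regular graph with probability
tending to `exp (-ab/2)`, uniformly in both graphs. -/
lemma uniform_prob_disjoint (a b : ℕ) {ε : ℝ} (hε : 0 < ε) : ∃ n₀ : ℕ, ∀ n, n₀ ≤ n →
    ∀ G H : SimpleGraph (Fin n), RowSum G a → RowSum H b →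
      |(Nat.card {σ : Perm (Fin n) // Disjoint H (G.comap σ)} : ℝ) / n.factorial -
        Real.exp (-(a * b / 2))| ≤ ε := by
  have h := (Metric.tendsto_nhds.1 (tendsto_levelProb_zero a b)) ε hε
  rw [regPairAtTop, eventually_comap, eventually_atTop] at h
  obtain ⟨n₀, h⟩ := h
  refine ⟨n₀, fun n hn G H hG hH => ?_⟩
  have := h n hn ⟨n, ⟨(G, H), hG, hH⟩⟩ rfl
  rw [Real.dist_eq] at this
  have e : Nat.card {σ : Perm (Fin n) // Disjoint H (G.comap σ)} = levelCount G H (2 * 0) := by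
    rw [levelCount, Nat.subtype_card]
    simp [sharedCount_eq_zero_iff]
  rw [e]
  exact this.le

end PoissonLimit

section Relabelling

open Finset Equiv

lemma isRegularGraph_iff_rowSum {n : ℕ} {G : SimpleGraph (Fin n)} {d : ℕ} :
    IsRegularGraph G d ↔ RowSum G d := by
  classical
  refine forall_congr' fun u => ?_
  rw [gDeg, Nat.subtype_card (univ.filter (G.Adj u)) (by simp), Finset.card_filter]
  simp only [adjInd]

/-- Relabelling by a permutation, as an automorphism of the lattice of graphs. -/
def comapIso {V : Type*} (σ : Perm V) : SimpleGraph V ≃o SimpleGraph V where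
  toFun G := G.comap σ
  invFun G := G.comap σ.symm
  left_inv G := by ext; simp
  right_inv G := by ext; simp
  map_rel_iff' {G H} := by
    refine ⟨fun h u v huv => ?_, fun h u v huv => h huv⟩
    simpa using @h (σ.symm u) (σ.symm v) (by simpa using huv)

@[simp] lemma comapIso_apply {V : Type*} (σ : Perm V) (G : SimpleGraph V) :
    comapIso σ G = G.comap σ := rfl

lemma RowSum.comap {V : Type*} [Fintype V] {G : SimpleGraph V} {a : ℕ} (hG : RowSum G a)
    (σ : Perm V) : RowSum (G.comap σ) a := by
  intro u
  exact hG.sum_perm σ (σ u)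

lemma rowSum_iSup {V : Type*} [Fintype V] {k d : ℕ} {f : Fin k → SimpleGraph V}
    (hf : ∀ i, RowSum (f i) d) (hdisj : ∀ i j, i ≠ j → Disjoint (f i) (f j)) :
    RowSum (⨆ i, f i) (k * d) := by
  classical
  have key : ∀ u v, adjInd (⨆ i, f i) u v = ∑ i, adjInd (f i) u v := by
    intro u v
    by_cases h : ∃ i, (f i).Adj u v
    · obtain ⟨i, hi⟩ := h
      have h1 : adjInd (⨆ i, f i) u v = 1 := by
        have : (⨆ i, f i).Adj u v := SimpleGraph.iSup_adj.2 ⟨i, hi⟩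
        simp [adjInd, this]
      rw [h1, Finset.sum_eq_single i]
      · simp [adjInd, hi]
      · intro j _ hj
        have h2 : ¬ (f i ⊓ f j).Adj u v := by rw [(hdisj i j hj.symm).eq_bot]; simp
        have : ¬ (f j).Adj u v := fun h3 => h2 ⟨hi, h3⟩
        simp [adjInd, this]
      · simp
    · have h1 : ¬ (⨆ i, f i).Adj u v := fun h' => h (SimpleGraph.iSup_adj.1 h')
      push Not at h
      simp [adjInd, h]
  intro u
  simp_rw [key]
  rw [Finset.sum_comm]
  simp_rw [hf _ u]
  simp

/-- The number of `k`-tuples of relabellings which put the graphs `B i` in a position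
satisfying `Q`. -/
noncomputable def comapCount {n k : ℕ} (Q : (Fin k → SimpleGraph (Fin n)) → Prop)
    (B : Fin k → SimpleGraph (Fin n)) : ℕ :=
  Nat.card {σ : Fin k → Perm (Fin n) // Q fun i => (B i).comap (σ i)}

lemma nonempty_iso_iff {V : Type*} (B f : SimpleGraph V) :
    Nonempty (B ≃g f) ↔ ∃ σ : Perm V, B.comap σ = f := by
  constructor
  · rintro ⟨e⟩
    refine ⟨e.symm.toEquiv, ?_⟩
    ext u v
    exact e.symm.map_rel_iff
  · rintro ⟨σ, rfl⟩
    exact ⟨⟨σ.symm, by simp⟩⟩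

lemma card_comap_eq {V : Type*} {B f : SimpleGraph V} (h : Nonempty (B ≃g f)) :
    Nat.card {σ : Perm V // B.comap σ = f} = Nat.card {σ : Perm V // B.comap σ = B} := by
  obtain ⟨τ, rfl⟩ := (nonempty_iso_iff B f).1 h
  refine Nat.card_congr ((Equiv.mulRight τ⁻¹).subtypeEquiv fun σ => ?_)
  constructor
  · intro h
    ext u v
    have := congrArg (fun K : SimpleGraph V => K.Adj (τ⁻¹ u) (τ⁻¹ v)) h
    simpa using this
  · intro h
    ext u v
    have := congrArg (fun K : SimpleGraph V => K.Adj (τ u) (τ v)) h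
    simpa using this

lemma comapCount_eq {n k : ℕ} (Q : (Fin k → SimpleGraph (Fin n)) → Prop)
    (B : Fin k → SimpleGraph (Fin n)) :
    comapCount Q B =
      Nat.card {f : Fin k → SimpleGraph (Fin n) // (∀ i, Nonempty (B i ≃g f i)) ∧ Q f} *
        ∏ i, Nat.card {σ : Perm (Fin n) // (B i).comap σ = B i} := by
  classical
  let e : {σ : Fin k → Perm (Fin n) // Q fun i => (B i).comap (σ i)} ≃
      Σ f : {f : Fin k → SimpleGraph (Fin n) // (∀ i, Nonempty (B i ≃g f i)) ∧ Q f},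
        ∀ i, {σ : Perm (Fin n) // (B i).comap σ = f.1 i} :=
    { toFun := fun σ => ⟨⟨fun i => (B i).comap (σ.1 i),
          fun i => (nonempty_iso_iff _ _).2 ⟨σ.1 i, rfl⟩, σ.2⟩, fun i => ⟨σ.1 i, rfl⟩⟩
      invFun := fun x => ⟨fun i => (x.2 i).1, by
        have : (fun i => (B i).comap (x.2 i).1) = x.1.1 := funext fun i => (x.2 i).2
        rw [this]; exact x.1.2.2⟩
      left_inv := fun σ => rfl
      right_inv := by
        rintro ⟨⟨f, hf⟩, g⟩
        refine Sigma.ext (Subtype.ext (funext fun i => (g i).2)) ?_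
        refine Function.hfunext rfl fun i j hij => ?_
        cases hij
        refine (Subtype.heq_iff_coe_eq fun σ => ?_).2 rfl
        exact iff_of_eq (congrArg (fun K => (B i).comap σ = K) (g i).2) }
  rw [comapCount, Nat.card_congr e, Nat.card_sigma]
  simp_rw [Nat.card_pi]
  rw [Finset.sum_congr rfl fun f _ => Finset.prod_congr rfl fun i _ => card_comap_eq (f.2.1 i)]
  simp [Nat.card_eq_fintype_card]

/-- The graphs `f i` are pairwise edge-disjoint. -/
def PairwiseDisj {V : Type*} {k : ℕ} (f : Fin k → SimpleGraph V) : Prop :=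
  ∀ i j, i ≠ j → Disjoint (f i) (f j)

/-- The graphs `f i` are pairwise edge-disjoint with union `G`. -/
def Decomposes {V : Type*} {k : ℕ} (G : SimpleGraph V) (f : Fin k → SimpleGraph V) : Prop :=
  PairwiseDisj f ∧ ⨆ i, f i = G

lemma nTuplesTo_div_nTuples {n k : ℕ} (B : Fin k → SimpleGraph (Fin n))
    (G : SimpleGraph (Fin n)) :
    (nTuplesTo k B G : ℝ) / nTuples k B =
      (comapCount (Decomposes G) B : ℝ) / comapCount PairwiseDisj B := by
  have hpos : (0 : ℝ) < ((∏ i, Nat.card {σ : Perm (Fin n) // (B i).comap σ = B i} : ℕ) : ℝ) := by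
    rw [Nat.cast_pos]
    refine Finset.prod_pos fun i _ => ?_
    have : Nonempty {σ : Perm (Fin n) // (B i).comap σ = B i} := ⟨⟨1, by ext; simp⟩⟩
    exact Nat.card_pos
  rw [comapCount_eq, comapCount_eq, Nat.cast_mul, Nat.cast_mul, mul_div_mul_right _ _ hpos.ne']
  rfl

open scoped Classical in
lemma comapCount_cons {n k : ℕ} (B : Fin (k + 1) → SimpleGraph (Fin n)) :
    comapCount PairwiseDisj B =
      ∑ σ : {σ : Fin k → Perm (Fin n) // PairwiseDisj fun i => (B i.succ).comap (σ i)},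
        Nat.card {τ : Perm (Fin n) //
          Disjoint (⨆ i, (B i.succ).comap (σ.1 i)) ((B 0).comap τ)} := by
  have hiff : ∀ f : Fin (k + 1) → SimpleGraph (Fin n), PairwiseDisj f ↔
      PairwiseDisj (fun i : Fin k => f i.succ) ∧ Disjoint (⨆ i : Fin k, f i.succ) (f 0) := by
    intro f
    rw [iSup_disjoint_iff]
    constructor
    · exact fun h => ⟨fun i j hij => h _ _ (by simpa using hij),
        fun i => h _ _ (Fin.succ_ne_zero i)⟩
    · rintro ⟨h1, h2⟩ i j hij
      induction i using Fin.cases with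
      | zero =>
        induction j using Fin.cases with
        | zero => exact absurd rfl hij
        | succ j => exact (h2 j).symm
      | succ i =>
        induction j using Fin.cases with
        | zero => exact h2 i
        | succ j => exact h1 i j (by simpa using hij)
  let e : {σ : Fin (k + 1) → Perm (Fin n) // PairwiseDisj fun i => (B i).comap (σ i)} ≃
      Σ σ : {σ : Fin k → Perm (Fin n) // PairwiseDisj fun i => (B i.succ).comap (σ i)},
        {τ : Perm (Fin n) // Disjoint (⨆ i, (B i.succ).comap (σ.1 i)) ((B 0).comap τ)} :=
    { toFun := fun σ => ⟨⟨fun i => σ.1 i.succ, ((hiff _).1 σ.2).1⟩, ⟨σ.1 0, ((hiff _).1 σ.2).2⟩⟩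
      invFun := fun x => ⟨Fin.cons x.2.1 x.1.1, (hiff _).2 ⟨x.1.2, x.2.2⟩⟩
      left_inv := fun σ => Subtype.ext (Fin.cons_self_tail σ.1)
      right_inv := fun x => rfl }
  rw [comapCount, Nat.card_congr e, Nat.card_sigma]

/-- The probability that random relabellings of `k` given `d`-regular graphs are pairwise
edge-disjoint converges to a positive constant, uniformly in the graphs. -/
lemma exists_uniform_limit (k d : ℕ) : ∃ c : ℝ, 0 < c ∧ ∀ ε : ℝ, 0 < ε → ∃ n₀ : ℕ, ∀ n, n₀ ≤ n →
    ∀ B : Fin k → SimpleGraph (Fin n), (∀ i, RowSum (B i) d) →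
      |(comapCount PairwiseDisj B : ℝ) / (n.factorial : ℝ) ^ k - c| ≤ ε := by
  classical
  induction k with
  | zero =>
    refine ⟨1, one_pos, fun ε hε => ⟨0, fun n _ B _ => ?_⟩⟩
    have : comapCount PairwiseDisj B = 1 := by
      rw [comapCount, Nat.card_eq_one_iff_unique]
      exact ⟨inferInstance, ⟨⟨fun i => i.elim0, fun i => i.elim0⟩⟩⟩
    simp [this, hε.le]
  | succ k ih =>
    obtain ⟨c, hc, ih⟩ := ih
    set q := Real.exp (-((d : ℝ) * (k * d : ℕ) / 2)) with hq
    have hq1 : q ≤ 1 := Real.exp_le_one_iff.2 (by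
      have : (0 : ℝ) ≤ (d : ℝ) * (k * d : ℕ) / 2 := by positivity
      linarith)
    have hq0 : 0 < q := Real.exp_pos _
    refine ⟨c * q, mul_pos hc hq0, fun ε hε => ?_⟩
    obtain ⟨n₁, h1⟩ := ih (min (ε / 2) 1) (lt_min (by positivity) one_pos)
    obtain ⟨n₂, h2⟩ := uniform_prob_disjoint d (k * d) (ε := ε / (2 * (c + 1))) (by positivity)
    refine ⟨max n₁ n₂, fun n hn B hB => ?_⟩
    have h1 := h1 n (le_of_max_le_left hn) (fun i => B i.succ) fun i => hB _
    have h2 := h2 n (le_of_max_le_right hn)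
    have hF : (0 : ℝ) < n.factorial := by positivity
    set F : ℝ := (n.factorial : ℝ)
    set x : ℝ := (comapCount PairwiseDisj fun i => B i.succ : ℝ) / F ^ k with hx
    have hcard : (Fintype.card {σ : Fin k → Perm (Fin n) //
        PairwiseDisj fun i => (B i.succ).comap (σ i)} : ℝ) = x * F ^ k := by
      rw [hx, div_mul_cancel₀ _ (by positivity), comapCount, Nat.card_eq_fintype_card]
    have hstep : |(comapCount PairwiseDisj B : ℝ) / F ^ (k + 1) - x * q| ≤
        x * (ε / (2 * (c + 1))) := by
      have e1 : (comapCount PairwiseDisj B : ℝ) / F ^ (k + 1) - x * q = (∑ σ :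
          {σ : Fin k → Perm (Fin n) // PairwiseDisj fun i => (B i.succ).comap (σ i)},
          ((Nat.card {τ : Perm (Fin n) //
            Disjoint (⨆ i, (B i.succ).comap (σ.1 i)) ((B 0).comap τ)} : ℝ) / F - q)) / F ^ k := by
        rw [comapCount_cons, Finset.sum_sub_distrib, ← Finset.sum_div, Finset.sum_const,
          Finset.card_univ, nsmul_eq_mul, hcard]
        push_cast
        field_simp
        ring
      rw [e1, abs_div, abs_of_pos (by positivity : 0 < F ^ k), div_le_iff₀ (by positivity)]
      refine (Finset.abs_sum_le_sum_abs _ _).trans ?_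
      calc _ ≤ ∑ σ : {σ : Fin k → Perm (Fin n) //
            PairwiseDisj fun i => (B i.succ).comap (σ i)}, ε / (2 * (c + 1)) :=
            Finset.sum_le_sum fun σ _ => h2 _ _ (hB 0)
              (rowSum_iSup (fun i => (hB _).comap _) σ.2)
        _ = _ := by
            rw [Finset.sum_const, Finset.card_univ, nsmul_eq_mul, hcard]; ring
    have hx1 : x ≤ c + 1 := by
      have := (abs_le.1 (h1.trans (min_le_right _ _))).2
      linarith
    have h3 : x * (ε / (2 * (c + 1))) ≤ ε / 2 := by
      calc _ ≤ (c + 1) * (ε / (2 * (c + 1))) := by gcongr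
        _ = ε / 2 := by field_simp
    have h4 : |(x - c) * q| ≤ ε / 2 := by
      rw [abs_mul, abs_of_pos hq0]
      have := h1.trans (min_le_left _ _)
      nlinarith [abs_nonneg (x - c)]
    have h5 := hstep.trans h3
    rw [abs_le] at h4 h5 ⊢
    constructor <;> nlinarith [h4.1, h4.2, h5.1, h5.2]

end Relabelling

section Factorisations

open Finset Equiv

/-- `f` is a 1-factorisation of `G`. -/
def IsFactorisation {n d : ℕ} (G : SimpleGraph (Fin n)) (f : Fin d → SimpleGraph (Fin n)) : Prop :=
  (∀ i, IsRegularGraph (f i) 1) ∧ Decomposes G f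

lemma nFact_eq {n d : ℕ} (G : SimpleGraph (Fin n)) :
    nFact d G = Nat.card {f : Fin d → SimpleGraph (Fin n) // IsFactorisation G f} := rfl

lemma IsFactorisation.rowSum {n d : ℕ} {G : SimpleGraph (Fin n)}
    {f : Fin d → SimpleGraph (Fin n)} (h : IsFactorisation G f) : RowSum G d := by
  have := rowSum_iSup (fun i => isRegularGraph_iff_rowSum.1 (h.1 i)) h.2.1
  rwa [h.2.2, mul_one] at this

lemma rowSum_of_nFact_ne_zero {n d : ℕ} {G : SimpleGraph (Fin n)} (h : nFact d G ≠ 0) :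
    RowSum G d := by
  have : Nonempty {f : Fin d → SimpleGraph (Fin n) // IsFactorisation G f} := by
    by_contra hne
    rw [not_nonempty_iff] at hne
    exact h (by rw [nFact_eq, Nat.card_of_isEmpty])
  exact this.some.2.rowSum

lemma isRegularGraph_comap_iff {n d : ℕ} (G : SimpleGraph (Fin n)) (σ : Perm (Fin n)) :
    IsRegularGraph (G.comap σ) d ↔ IsRegularGraph G d := by
  rw [isRegularGraph_iff_rowSum, isRegularGraph_iff_rowSum]
  refine ⟨fun h => ?_, fun h => h.comap σ⟩
  have := h.comap σ.symm
  rwa [show (G.comap σ).comap σ.symm = G by ext; simp] at this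

lemma nFact_comap {n d : ℕ} (G : SimpleGraph (Fin n)) (σ : Perm (Fin n)) :
    nFact d (G.comap σ) = nFact d G := by
  rw [nFact_eq, nFact_eq]
  symm
  refine Nat.card_congr ((Equiv.piCongrRight fun _ => (comapIso σ).toEquiv).subtypeEquiv
    fun f => ?_)
  have e : (⨆ i, comapIso σ (f i)) = comapIso σ (⨆ i, f i) := ((comapIso σ).map_iSup f).symm
  have e' : (comapIso σ (⨆ i, f i) = comapIso σ G) ↔ (⨆ i, f i) = G := (comapIso σ).injective.eq_iff
  change _ ↔ (∀ i, IsRegularGraph ((f i).comap σ) 1) ∧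
    (∀ i j, i ≠ j → Disjoint (comapIso σ (f i)) (comapIso σ (f j))) ∧
    (⨆ i, comapIso σ (f i)) = comapIso σ G
  simp only [isRegularGraph_comap_iff, disjoint_map_orderIso_iff, e, e']
  rfl

lemma isFactorisation_prod_iff {n k d : ℕ} {G : SimpleGraph (Fin n)}
    {f : Fin (k * d) → SimpleGraph (Fin n)} :
    IsFactorisation G f ↔
      (∀ i, IsFactorisation (⨆ j, f (finProdFinEquiv (i, j))) fun j => f (finProdFinEquiv (i, j))) ∧
        Decomposes G fun i => ⨆ j, f (finProdFinEquiv (i, j)) := by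
  have hsup : (⨆ x, f x) = ⨆ i, ⨆ j, f (finProdFinEquiv (i, j)) := by
    rw [← finProdFinEquiv.iSup_comp, iSup_prod]
  constructor
  · rintro ⟨h1, h2, h3⟩
    refine ⟨fun i => ⟨fun j => h1 _, fun j j' hj => h2 _ _ (by simpa using hj), rfl⟩, ?_, ?_⟩
    · intro i i' hi
      simp only [iSup_disjoint_iff, disjoint_iSup_iff]
      exact fun j j' => h2 _ _ (by simp [hi])
    · rw [← h3, hsup]
  · rintro ⟨h1, h2, h3⟩
    refine ⟨fun x => ?_, fun x y hxy => ?_, hsup.trans h3⟩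
    · obtain ⟨⟨i, j⟩, rfl⟩ := finProdFinEquiv.surjective x
      exact (h1 i).1 j
    · obtain ⟨⟨i, j⟩, rfl⟩ := finProdFinEquiv.surjective x
      obtain ⟨⟨i', j'⟩, rfl⟩ := finProdFinEquiv.surjective y
      by_cases hi : i = i'
      · subst hi
        exact (h1 i).2.1 j j' (by rintro rfl; exact hxy rfl)
      · have := h2 i i' hi
        simp only [iSup_disjoint_iff, disjoint_iSup_iff] at this
        exact this j' j

open scoped Classical in
/-- Grouping the factors of a 1-factorisation with `k * d` factors into blocks of size `d`. -/
lemma nFact_mul_eq_sum {n : ℕ} (k d : ℕ) (G : SimpleGraph (Fin n)) :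
    nFact (k * d) G = ∑ B : Fin k → SimpleGraph (Fin n),
      (∏ i, nFact d (B i)) * if Decomposes G B then 1 else 0 := by
  let φ : {f : Fin (k * d) → SimpleGraph (Fin n) // IsFactorisation G f} →
      {B : Fin k → SimpleGraph (Fin n) // Decomposes G B} :=
    fun f => ⟨fun i => ⨆ j, f.1 (finProdFinEquiv (i, j)), (isFactorisation_prod_iff.1 f.2).2⟩
  have hfib : ∀ B, Nat.card {f // φ f = B} = ∏ i, nFact d (B.1 i) := by
    intro B
    simp_rw [nFact_eq]
    rw [← Nat.card_pi]
    have hg : ∀ (g : ∀ i, {h : Fin d → SimpleGraph (Fin n) // IsFactorisation (B.1 i) h}) i j,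
        (g (finProdFinEquiv.symm (finProdFinEquiv (i, j))).1).1
          (finProdFinEquiv.symm (finProdFinEquiv (i, j))).2 = (g i).1 j := fun g i j =>
      congrArg (fun p : Fin k × Fin d => (g p.1).1 p.2)
        (finProdFinEquiv.symm_apply_apply (i, j))
    refine Nat.card_congr
      { toFun := fun f i => ⟨fun j => f.1.1 (finProdFinEquiv (i, j)), ?_⟩
        invFun := fun g => ⟨⟨fun x => (g (finProdFinEquiv.symm x).1).1 (finProdFinEquiv.symm x).2,
          ?_⟩, ?_⟩
        left_inv := ?_
        right_inv := ?_ }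
    · have h1 := (isFactorisation_prod_iff.1 f.1.2).1 i
      have h2 : (⨆ j, f.1.1 (finProdFinEquiv (i, j))) = B.1 i :=
        congrFun (congrArg Subtype.val f.2) i
      rwa [h2] at h1
    · rw [isFactorisation_prod_iff]
      simp only [hg]
      have h2 : ∀ i, (⨆ j, (g i).1 j) = B.1 i := fun i => (g i).2.2.2
      simp only [h2]
      exact ⟨fun i => (g i).2, B.2⟩
    · refine Subtype.ext (funext fun i => ?_)
      simp only [φ, hg]
      exact (g i).2.2.2
    · intro f
      refine Subtype.ext (Subtype.ext (funext fun x => ?_))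
      exact congrArg f.1.1 (finProdFinEquiv.apply_symm_apply x)
    · intro g
      refine funext fun i => Subtype.ext (funext fun j => ?_)
      exact hg g i j
  rw [nFact_eq, ← Nat.card_congr (Equiv.sigmaFiberEquiv φ), Nat.card_sigma]
  simp_rw [hfib, mul_ite, mul_one, mul_zero]
  rw [← Finset.sum_filter, Finset.sum_subtype (p := Decomposes G) _ (by simp)]

open scoped Classical in
lemma sum_weight_mul_comapCount {n k : ℕ} (d : ℕ)
    (Q : (Fin k → SimpleGraph (Fin n)) → Prop) :
    ∑ B : Fin k → SimpleGraph (Fin n), (∏ i, nFact d (B i)) * comapCount Q B =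
      n.factorial ^ k * ∑ B : Fin k → SimpleGraph (Fin n),
        (∏ i, nFact d (B i)) * if Q B then 1 else 0 := by
  have h : ∀ B : Fin k → SimpleGraph (Fin n), comapCount Q B =
      ∑ σ : Fin k → Perm (Fin n), if Q (fun i => (B i).comap (σ i)) then 1 else 0 := by
    intro B
    rw [comapCount, Nat.subtype_card (univ.filter fun σ : Fin k → Perm (Fin n) =>
      Q fun i => (B i).comap (σ i)) (by simp), Finset.card_filter]
  simp_rw [h, Finset.mul_sum]
  rw [Finset.sum_comm]
  have h2 : ∀ σ : Fin k → Perm (Fin n), ∑ B : Fin k → SimpleGraph (Fin n),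
      (∏ i, nFact d (B i)) * (if Q (fun i => (B i).comap (σ i)) then 1 else 0) =
      ∑ B : Fin k → SimpleGraph (Fin n), (∏ i, nFact d (B i)) * if Q B then 1 else 0 := by
    intro σ
    refine Eq.trans ?_ (Equiv.sum_comp (Equiv.piCongrRight fun i => (comapIso (σ i)).toEquiv)
      fun B : Fin k → SimpleGraph (Fin n) => (∏ i, nFact d (B i)) * if Q B then 1 else 0)
    refine Finset.sum_congr rfl fun B _ => ?_
    change _ = (∏ i, nFact d ((B i).comap (σ i))) * if Q (fun i => (B i).comap (σ i)) then 1 else 0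
    simp only [nFact_comap]
  rw [Finset.sum_congr rfl fun σ _ => h2 σ]
  simp [Fintype.card_perm, Finset.mul_sum]

lemma sum_weight_mul_comapCount_decomposes {n : ℕ} (k d : ℕ) (G : SimpleGraph (Fin n)) :
    ∑ B : Fin k → SimpleGraph (Fin n), (∏ i, nFact d (B i)) * comapCount (Decomposes G) B =
      n.factorial ^ k * nFact (k * d) G := by
  rw [sum_weight_mul_comapCount, nFact_mul_eq_sum]

lemma sum_weight_mul_comapCount_pairwiseDisj (n k d : ℕ) :
    ∑ B : Fin k → SimpleGraph (Fin n), (∏ i, nFact d (B i)) * comapCount PairwiseDisj B =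
      n.factorial ^ k * ∑ G : SimpleGraph (Fin n), nFact (k * d) G := by
  classical
  rw [sum_weight_mul_comapCount]
  simp_rw [nFact_mul_eq_sum]
  rw [Finset.sum_comm]
  congr 1
  refine Finset.sum_congr rfl fun B _ => ?_
  rw [← Finset.mul_sum]
  congr 1
  by_cases h : PairwiseDisj B <;> simp [Decomposes, h]

end Factorisations

/-- Averaging the ratios `y / x`, with `x` nearly constant on the support of the weight, nearly
gives the ratio of the averages. -/
lemma abs_sum_ratio_sub_le {ι : Type*} [Fintype ι] {U x y : ι → ℝ} {P c ε : ℝ}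
    (hU : ∀ B, 0 ≤ U B) (hy : ∀ B, 0 ≤ y B) (hP : ∑ B, U B = P) (hP0 : 0 < P) (hc : 0 < c)
    (hε : 0 < ε) (hε1 : ε ≤ 1 / 2) (hx : ∀ B, U B ≠ 0 → |x B - c| ≤ c * ε) :
    |∑ B, U B / P * (y B / x B) - (∑ B, U B * y B) / ∑ B, U B * x B| ≤
      4 * ε * ((∑ B, U B * y B) / ∑ B, U B * x B) := by
  set N := ∑ B, U B * y B with hN
  set Z := ∑ B, U B * x B with hZ
  have hN0 : 0 ≤ N := Finset.sum_nonneg fun B _ => mul_nonneg (hU B) (hy B)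
  have hx' : ∀ B, U B ≠ 0 → c * (1 - ε) ≤ x B ∧ x B ≤ c * (1 + ε) := by
    intro B hB
    have := abs_le.1 (hx B hB)
    constructor <;> linarith [this.1, this.2]
  have hlow : 0 < c * (1 - ε) := mul_pos hc (by linarith)
  have hZ1 : P * (c * (1 - ε)) ≤ Z := by
    rw [hZ, ← hP, Finset.sum_mul]
    refine Finset.sum_le_sum fun B _ => ?_
    by_cases hB : U B = 0
    · simp [hB]
    · exact mul_le_mul_of_nonneg_left (hx' B hB).1 (hU B)
  have hZ2 : Z ≤ P * (c * (1 + ε)) := by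
    rw [hZ, ← hP, Finset.sum_mul]
    refine Finset.sum_le_sum fun B _ => ?_
    by_cases hB : U B = 0
    · simp [hB]
    · exact mul_le_mul_of_nonneg_left (hx' B hB).2 (hU B)
  have hZ0 : 0 < Z := lt_of_lt_of_le (mul_pos hP0 hlow) hZ1
  have hterm : ∀ B, U B * y B / (P * (c * (1 + ε))) ≤ U B / P * (y B / x B) ∧
      U B / P * (y B / x B) ≤ U B * y B / (P * (c * (1 - ε))) := by
    intro B
    by_cases hB : U B = 0
    · simp [hB]
    have hpos := hlow.trans_le (hx' B hB).1
    rw [div_mul_div_comm]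
    have := mul_nonneg (hU B) (hy B)
    constructor
    · gcongr; exact (hx' B hB).2
    · gcongr; exact (hx' B hB).1
  have hup : ∑ B, U B / P * (y B / x B) ≤ N / (P * (c * (1 - ε))) := by
    rw [hN, Finset.sum_div]; exact Finset.sum_le_sum fun B _ => (hterm B).2
  have hdown : N / (P * (c * (1 + ε))) ≤ ∑ B, U B / P * (y B / x B) := by
    rw [hN, Finset.sum_div]; exact Finset.sum_le_sum fun B _ => (hterm B).1
  have h1 : N / (P * (c * (1 - ε))) ≤ (1 + 4 * ε) * (N / Z) := by
    rw [← mul_div_assoc, div_le_div_iff₀ (by positivity) hZ0]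
    have : Z ≤ (1 + 4 * ε) * (P * (c * (1 - ε))) := by
      refine hZ2.trans ?_
      have : 0 < P * c := by positivity
      have h2 : 1 + ε ≤ (1 + 4 * ε) * (1 - ε) := by nlinarith
      nlinarith
    nlinarith
  have h2 : (1 - 4 * ε) * (N / Z) ≤ N / (P * (c * (1 + ε))) := by
    rw [← mul_div_assoc, div_le_div_iff₀ hZ0 (by positivity)]
    have : (1 - 4 * ε) * (P * (c * (1 + ε))) ≤ Z := by
      refine le_trans ?_ hZ1
      have : 0 < P * c := by positivity
      have h2 : (1 - 4 * ε) * (1 + ε) ≤ 1 - ε := by nlinarith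
      nlinarith
    nlinarith
  rw [abs_le]
  constructor <;> linarith

/-- Fix `k, d ≥ 1`.  For every `ε > 0` there is `n₀` such that for
every even `n = 2m ≥ n₀` for which `η_{k,d,n}` is well defined, and every
`G ∈ 𝒢_{kd}(n)`, `|η_{k,d,n}(G) - ν_{kd,n}(G)| ≤ ε ν_{kd,n}(G)`. -/
theorem statement_16 (k d : ℕ) (hk : 1 ≤ k) (hd : 1 ≤ d) :
    ∀ ε : ℝ, 0 < ε → ∃ n₀ : ℕ, ∀ m : ℕ, n₀ ≤ 2*m →
      (∀ B : Fin k → SimpleGraph (Fin (2*m)),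
        (∀ i, IsRegularGraph (B i) d) → 0 < nTuples k B) →
      ∀ G : SimpleGraph (Fin (2*m)), IsRegularGraph G (k*d) →
        |etaASP k d (2*m) G - nu (2*m) (k*d) G| ≤ ε * nu (2*m) (k*d) G := by
  classical
  intro ε hε
  obtain ⟨c, hc, hlim⟩ := exists_uniform_limit k d
  obtain ⟨δ, hδ, hδ1, hδε⟩ : ∃ δ : ℝ, 0 < δ ∧ δ ≤ 1 / 2 ∧ 4 * δ ≤ ε :=
    ⟨min (1 / 2) (ε / 4), lt_min (by norm_num) (by positivity), min_le_left _ _, by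
      linarith [min_le_right (1 / 2) (ε / 4)]⟩
  obtain ⟨n₀, hn₀⟩ := hlim (c * δ) (by positivity)
  refine ⟨n₀, fun m hm _ G _ => ?_⟩
  have hlim := hn₀ (2 * m) hm
  generalize 2 * m = n at *
  have hη : etaASP k d n G = ∑ B : Fin k → SimpleGraph (Fin n),
      ((∏ i, (nFact d (B i) : ℝ)) / (∑ H : SimpleGraph (Fin n), (nFact d H : ℝ)) ^ k) *
        (((comapCount (Decomposes G) B : ℝ) / (n.factorial : ℝ) ^ k) /
          ((comapCount PairwiseDisj B : ℝ) / (n.factorial : ℝ) ^ k)) := by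
    rw [etaASP, tsum_fintype]
    refine Finset.sum_congr rfl fun B _ => ?_
    rw [nTuplesTo_div_nTuples, div_div_div_cancel_right₀ (by positivity)]
    simp only [nu, tsum_fintype, Finset.prod_div_distrib, Finset.prod_const, Finset.card_univ,
      Fintype.card_fin]
  have hν : nu n (k * d) G =
      (∑ B : Fin k → SimpleGraph (Fin n), (∏ i, (nFact d (B i) : ℝ)) *
        ((comapCount (Decomposes G) B : ℝ) / (n.factorial : ℝ) ^ k)) /
      ∑ B : Fin k → SimpleGraph (Fin n), (∏ i, (nFact d (B i) : ℝ)) *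
        ((comapCount PairwiseDisj B : ℝ) / (n.factorial : ℝ) ^ k) := by
    have h1 : ∑ B : Fin k → SimpleGraph (Fin n), (∏ i, (nFact d (B i) : ℝ)) *
        (comapCount (Decomposes G) B : ℝ) = (n.factorial : ℝ) ^ k * nFact (k * d) G := by
      exact_mod_cast sum_weight_mul_comapCount_decomposes k d G
    have h2 : ∑ B : Fin k → SimpleGraph (Fin n), (∏ i, (nFact d (B i) : ℝ)) *
        (comapCount PairwiseDisj B : ℝ) =
        (n.factorial : ℝ) ^ k * ∑ H : SimpleGraph (Fin n), (nFact (k * d) H : ℝ) := by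
      exact_mod_cast sum_weight_mul_comapCount_pairwiseDisj n k d
    simp_rw [← mul_div_assoc, ← Finset.sum_div]
    rw [h1, h2, nu, tsum_fintype, mul_div_cancel_left₀ _ (by positivity),
      mul_div_cancel_left₀ _ (by positivity)]
  have hsum : ∑ B : Fin k → SimpleGraph (Fin n), ∏ i, (nFact d (B i) : ℝ) =
      (∑ H : SimpleGraph (Fin n), (nFact d H : ℝ)) ^ k := by
    rw [Fintype.sum_pow]
  rcases (pow_nonneg (Finset.sum_nonneg fun H _ => Nat.cast_nonneg (nFact d H)) k :
    (0 : ℝ) ≤ (∑ H : SimpleGraph (Fin n), (nFact d H : ℝ)) ^ k).eq_or_lt with h0 | h0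
  · have hzero : ∀ B : Fin k → SimpleGraph (Fin n), ∏ i, (nFact d (B i) : ℝ) = 0 := by
      intro B
      have := (Finset.sum_eq_zero_iff_of_nonneg fun B _ =>
        Finset.prod_nonneg fun i _ => Nat.cast_nonneg (nFact d (B i))).1 (hsum.trans h0.symm)
      exact this B (Finset.mem_univ B)
    rw [hη, hν]
    simp [hzero]
  · rw [hη, hν]
    refine (abs_sum_ratio_sub_le (fun B => Finset.prod_nonneg fun i _ => Nat.cast_nonneg _)
      (fun B => by positivity) hsum h0 hc hδ hδ1 fun B hB => ?_).trans
      (mul_le_mul_of_nonneg_right hδε ?_)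
    · refine hlim B fun i => rowSum_of_nFact_ne_zero fun h => hB ?_
      exact Finset.prod_eq_zero (Finset.mem_univ i) (by simp [h])
    · rw [← hν]
      exact div_nonneg (Nat.cast_nonneg _) (tsum_nonneg fun H => Nat.cast_nonneg _)
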